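/- Let p be a prime, r ≥ 1, d = p^{2r}, and let K be an algebraic closure of ℚ_p with valuation v_p normalized by v_p(p) = 1. Let ζ ∈ K be a primitive d-th root of unity. Then for every 0 ≤ n ≤ d − 1: v_p(Ω_{r,n}(ζ)) ≥ r n / p^{2r} − 1/(p−1). In particular, max_{n ∈ [((1−δ)/2)(d−1), ((1+δ)/2)(d−1)]} |Ω_{r,n}(ζ)| → 0 as r → ∞, for any fixed 0 < δ < 1. -/

import Mathlib

/-- The `q`-Pochhammer symbol `(q;q)_n = ∏_{k=1}^n (1 - q^k)` in `ℤ[q]`. -/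
noncomputable def qPoch (n : ℕ) : Polynomial ℤ :=
  ∏ i ∈ Finset.range n, (1 - Polynomial.X ^ (i + 1))

section QBinomial

open Polynomial Finset

lemma qPoch_succ (n : ℕ) : qPoch (n + 1) = qPoch n * (1 - X ^ (n + 1)) :=
  prod_range_succ _ _

lemma qPoch_ne_zero (n : ℕ) : qPoch n ≠ 0 := by
  refine prod_ne_zero_iff.2 fun i _ h => ?_
  have := congrArg (eval 2) h
  simp only [eval_sub, eval_one, eval_pow, eval_X, eval_zero] at this
  have h2 : (1 : ℤ) < 2 ^ (i + 1) := one_lt_pow₀ (by norm_num) (by omega)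
  omega

variable {B : ℕ → ℕ → ℤ[X]}

lemma qBinom_zero_right
    (hB1 : ∀ n k : ℕ, k ≤ n → B n k * (qPoch k * qPoch (n - k)) = qPoch n)
    (n : ℕ) : B n 0 = 1 := by
  have h := hB1 n 0 (Nat.zero_le n)
  have h0 : qPoch 0 = 1 := prod_range_zero _
  rw [h0, one_mul, Nat.sub_zero] at h
  exact mul_right_cancel₀ (qPoch_ne_zero n) (by rw [h, one_mul])

lemma qBinom_self
    (hB1 : ∀ n k : ℕ, k ≤ n → B n k * (qPoch k * qPoch (n - k)) = qPoch n)
    (n : ℕ) : B n n = 1 := by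
  have h := hB1 n n le_rfl
  have h0 : qPoch 0 = 1 := prod_range_zero _
  rw [Nat.sub_self, h0, mul_one] at h
  exact mul_right_cancel₀ (qPoch_ne_zero n) (by rw [h, one_mul])

/-- The `q`-Pascal rule. -/
lemma qBinom_succ_succ
    (hB0 : ∀ n k : ℕ, n < k → B n k = 0)
    (hB1 : ∀ n k : ℕ, k ≤ n → B n k * (qPoch k * qPoch (n - k)) = qPoch n)
    (n k : ℕ) (hk : k ≤ n) :
    B (n + 1) (k + 1) = X ^ (k + 1) * B n (k + 1) + B n k := by
  rcases hk.eq_or_lt with rfl | hlt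
  · rw [qBinom_self hB1, qBinom_self hB1, hB0 _ _ (Nat.lt_succ_self _), mul_zero, zero_add]
  · obtain ⟨m, rfl⟩ := Nat.exists_eq_add_of_lt hlt
    have e1 := hB1 (k + m + 1 + 1) (k + 1) (by omega)
    have e2 := hB1 (k + m + 1) (k + 1) (by omega)
    have e3 := hB1 (k + m + 1) k (by omega)
    rw [show k + m + 1 + 1 - (k + 1) = m + 1 by omega] at e1
    rw [show k + m + 1 - (k + 1) = m by omega] at e2
    rw [show k + m + 1 - k = m + 1 by omega] at e3
    refine mul_right_cancel₀ (mul_ne_zero (qPoch_ne_zero (k + 1)) (qPoch_ne_zero (m + 1))) ?_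
    rw [e1, qPoch_succ (k + m + 1), add_mul]
    have e4 : X ^ (k + 1) * B (k + m + 1) (k + 1) * (qPoch (k + 1) * qPoch (m + 1))
        = X ^ (k + 1) * (1 - X ^ (m + 1)) * qPoch (k + m + 1) := by
      rw [← e2, qPoch_succ m]; ring
    have e5 : B (k + m + 1) k * (qPoch (k + 1) * qPoch (m + 1))
        = (1 - X ^ (k + 1)) * qPoch (k + m + 1) := by
      rw [← e3, qPoch_succ k]; ring
    rw [e4, e5]; ring

/-- The `q`-binomial theorem. -/
lemma prod_pow_sub_eq_sum_qBinom
    (hB0 : ∀ n k : ℕ, n < k → B n k = 0)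
    (hB1 : ∀ n k : ℕ, k ≤ n → B n k * (qPoch k * qPoch (n - k)) = qPoch n)
    {R : Type*} [CommRing R] (q t : R) (n : ℕ) :
    ∏ i ∈ range n, (q ^ i - t) =
      ∑ j ∈ range (n + 1), (-t) ^ j * q ^ ((n - j).choose 2) * (B n j).eval₂ (Int.castRingHom R) q := by
  induction n with
  | zero => simp [qBinom_zero_right hB1]
  | succ n ih =>
    rw [prod_range_succ, ih, sum_range_succ' _ (n + 1), mul_sub, sum_mul, sum_mul]
    have hterm : ∀ j ∈ range (n + 1),
        (-t) ^ (j + 1) * q ^ ((n + 1 - (j + 1)).choose 2) *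
          (B (n + 1) (j + 1)).eval₂ (Int.castRingHom R) q =
          (-t) ^ (j + 1) * q ^ ((n - (j + 1)).choose 2) * (B n (j + 1)).eval₂ (Int.castRingHom R) q * q ^ n
          - (-t) ^ j * q ^ ((n - j).choose 2) * (B n j).eval₂ (Int.castRingHom R) q * t := by
      intro j hj
      have hj' : j ≤ n := Nat.lt_succ_iff.1 (mem_range.1 hj)
      rw [qBinom_succ_succ hB0 hB1 n j hj', Nat.add_sub_add_right]
      rcases hj'.eq_or_lt with rfl | hlt
      · rw [hB0 j (j + 1) (Nat.lt_succ_self _)]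
        simp only [mul_zero, zero_add, eval₂_zero, zero_mul]
        ring
      · obtain ⟨m, rfl⟩ := Nat.exists_eq_add_of_lt hlt
        rw [show j + m + 1 - j = m + 1 by omega, show j + m + 1 - (j + 1) = m by omega,
          Nat.choose_succ_succ' m 1, Nat.choose_one_right]
        simp only [eval₂_add, eval₂_mul, eval₂_pow, eval₂_X]
        ring
    rw [sum_congr rfl hterm, sum_sub_distrib]
    have hs : ∑ j ∈ range (n + 1), (-t) ^ j * q ^ ((n - j).choose 2) * (B n j).eval₂ (Int.castRingHom R) q * q ^ n
        = ∑ j ∈ range (n + 1),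
            (-t) ^ (j + 1) * q ^ ((n - (j + 1)).choose 2) * (B n (j + 1)).eval₂ (Int.castRingHom R) q * q ^ n
          + (-t) ^ 0 * q ^ ((n - 0).choose 2) * (B n 0).eval₂ (Int.castRingHom R) q * q ^ n := by
      rw [← sum_range_succ' (fun j => (-t) ^ j * q ^ ((n - j).choose 2) * (B n j).eval₂ (Int.castRingHom R) q * q ^ n),
        sum_range_succ _ (n + 1), hB0 n (n + 1) (Nat.lt_succ_self _)]
      simp
    rw [hs, qBinom_zero_right hB1, qBinom_zero_right hB1, Nat.sub_zero, Nat.sub_zero,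
      Nat.choose_succ_succ' n 1, Nat.choose_one_right]
    ring

/-- The polynomial `∑_{N ∣ j} (-1)^j q^{(n-j)(n-j-1)/2} [n choose j]_q`, which is
`q^{n(n-1)/2} Ω(q)`. -/
noncomputable def omegaPoly (B : ℕ → ℕ → ℤ[X]) (N n : ℕ) : ℤ[X] :=
  ∑ k ∈ range (n / N + 1), (-1) ^ (k * N) * X ^ ((n - k * N).choose 2) * B n (k * N)

lemma sum_range_dvd {M : Type*} [AddCommMonoid M] (N n : ℕ) (hN : 0 < N) (f : ℕ → M) :
    ∑ j ∈ range (n + 1), (if N ∣ j then f j else 0) = ∑ k ∈ range (n / N + 1), f (k * N) := by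
  rw [← sum_filter]
  symm
  refine sum_bij (fun k _ => k * N) ?_ ?_ ?_ (fun _ _ => rfl)
  · intro k hk
    have hk' : k ≤ n / N := Nat.lt_succ_iff.1 (mem_range.1 hk)
    exact mem_filter.2 ⟨mem_range.2 (Nat.lt_succ_iff.2 ((Nat.le_div_iff_mul_le hN).1 hk')),
      dvd_mul_left _ _⟩
  · intro a _ b _ h
    exact Nat.eq_of_mul_eq_mul_right hN h
  · intro j hj
    obtain ⟨hj1, k, rfl⟩ := mem_filter.1 hj
    refine ⟨k, mem_range.2 (Nat.lt_succ_iff.2 ((Nat.le_div_iff_mul_le hN).2 ?_)), mul_comm _ _⟩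
    rw [mul_comm]
    exact Nat.lt_succ_iff.1 (mem_range.1 hj1)

lemma IsPrimitiveRoot.sum_pow_pow_eq {R : Type*} [CommRing R] [IsDomain R] {ω : R} {N : ℕ}
    (hω : IsPrimitiveRoot ω N) (j : ℕ) :
    ∑ s ∈ range N, (ω ^ s) ^ j = if N ∣ j then (N : R) else 0 := by
  simp_rw [← pow_mul, mul_comm _ j, pow_mul]
  split_ifs with h
  · rw [(hω.pow_eq_one_iff_dvd j).2 h]; simp
  · have h1 : ω ^ j - 1 ≠ 0 := fun h' => h ((hω.pow_eq_one_iff_dvd j).1 (sub_eq_zero.1 h'))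
    refine (mul_eq_zero.1 ?_).resolve_right h1
    rw [geom_sum_mul, ← pow_mul, mul_comm, pow_mul, hω.pow_eq_one, one_pow, sub_self]

/-- `Ω` as a sum over the `N`-th roots of unity. -/
lemma natCast_mul_omegaPoly
    (hB0 : ∀ n k : ℕ, n < k → B n k = 0)
    (hB1 : ∀ n k : ℕ, k ≤ n → B n k * (qPoch k * qPoch (n - k)) = qPoch n)
    {K : Type*} [Field K] {ω : K} {N : ℕ} (hN : 0 < N)
    (hω : IsPrimitiveRoot ω N) (n : ℕ) :
    (N : K[X]) * (omegaPoly B N n).map (Int.castRingHom K) =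
      ∑ s ∈ range N, ∏ i ∈ range n, (X ^ i - C (ω ^ s)) := by
  have hC : IsPrimitiveRoot (C ω) N := hω.map_of_injective C_injective
  have key : ∀ s ∈ range N, ∏ i ∈ range n, ((X : K[X]) ^ i - C (ω ^ s)) =
      ∑ j ∈ range (n + 1), (C ω ^ s) ^ j *
        ((-1) ^ j * X ^ ((n - j).choose 2) * (B n j).eval₂ (Int.castRingHom K[X]) X) := by
    intro s _
    rw [prod_pow_sub_eq_sum_qBinom hB0 hB1]
    refine sum_congr rfl fun j _ => ?_
    rw [C_pow, neg_pow]; ring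
  rw [sum_congr rfl key, sum_comm]
  simp_rw [← sum_mul, hC.sum_pow_pow_eq, ite_mul, zero_mul]
  rw [sum_range_dvd N n hN, ← mul_sum, omegaPoly, Polynomial.map_sum]
  congr 1
  refine sum_congr rfl fun k _ => ?_
  simp only [Polynomial.map_mul, Polynomial.map_pow, Polynomial.map_neg, Polynomial.map_one,
    Polynomial.map_X]
  rfl

end QBinomial

section Divisibility

open Polynomial Finset

variable {K : Type*} [Field K]

lemma cyclotomic_dvd_prod_block {m : ℕ} {μ₀ t : K} (hμ₀ : IsPrimitiveRoot μ₀ m) (hm : 0 < m)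
    (ht : t ^ m = 1) (a : ℕ) :
    cyclotomic m K ∣ ∏ i ∈ range m, (X ^ (a + i) - C t) := by
  have : NeZero m := ⟨hm.ne'⟩
  rw [cyclotomic_eq_prod_X_sub_primitiveRoots hμ₀]
  refine Finset.prod_dvd_of_coprime
    ((pairwise_coprime_X_sub_C Function.injective_id).set_pairwise _) fun μ hμ => ?_
  have hμ' : IsPrimitiveRoot μ m := isPrimitiveRoot_of_mem_primitiveRoots hμ
  have hμ0 : μ ≠ 0 := hμ'.ne_zero hm.ne'
  obtain ⟨i, hi, hit⟩ := hμ'.eq_pow_of_pow_eq_one (ξ := t * (μ ^ a)⁻¹) (by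
    rw [mul_pow, ht, inv_pow, ← pow_mul, mul_comm a, pow_mul, hμ'.pow_eq_one]; simp)
  refine dvd_trans ?_ (dvd_prod_of_mem _ (mem_range.2 hi))
  change X - C μ ∣ _
  rw [dvd_iff_isRoot, IsRoot.def, eval_sub, eval_pow, eval_X, eval_C, pow_add, hit,
    mul_left_comm, mul_inv_cancel₀ (pow_ne_zero a hμ0), mul_one, sub_self]

lemma cyclotomic_pow_dvd_prod {m : ℕ} {μ₀ t : K} (hμ₀ : IsPrimitiveRoot μ₀ m) (hm : 0 < m)
    (ht : t ^ m = 1) (n : ℕ) :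
    cyclotomic m K ^ (n / m) ∣ ∏ i ∈ range n, (X ^ i - C t) := by
  have h : ∀ k, cyclotomic m K ^ k ∣ ∏ i ∈ range (m * k), (X ^ i - C t) := by
    intro k
    induction k with
    | zero => simp
    | succ k ih =>
      rw [Nat.mul_succ, prod_range_add, pow_succ]
      exact mul_dvd_mul ih (cyclotomic_dvd_prod_block hμ₀ hm ht _)
  exact (h _).trans (prod_dvd_prod_of_subset _ _ _ (range_mono (Nat.mul_div_le n m)))

lemma isCoprime_cyclotomic [CharZero K] {m n : ℕ} (h : m ≠ n) :
    IsCoprime (cyclotomic m K) (cyclotomic n K) := by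
  have := (cyclotomic.isCoprime_rat h).map (mapRingHom (algebraMap ℚ K))
  simpa using this

/-- `Ω` is divisible by `∏_{e = r}^{2r-1} Φ_{p^e}^{⌊n / p^e⌋}`. -/
lemma prod_cyclotomic_dvd_omegaPoly [CharZero K] {B : ℕ → ℕ → ℤ[X]}
    (hB0 : ∀ n k : ℕ, n < k → B n k = 0)
    (hB1 : ∀ n k : ℕ, k ≤ n → B n k * (qPoch k * qPoch (n - k)) = qPoch n)
    {p r : ℕ} (hp : p.Prime) {ζ : K} (hζ : IsPrimitiveRoot ζ (p ^ (2 * r))) (n : ℕ) :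
    ∏ e ∈ Ico r (2 * r), cyclotomic (p ^ e) ℤ ^ (n / p ^ e) ∣ omegaPoly B (p ^ r) n := by
  have hroot : ∀ e ≤ 2 * r, ∃ μ : K, IsPrimitiveRoot μ (p ^ e) := fun e he =>
    ⟨_, hζ.pow (pow_pos hp.pos _) (by rw [← pow_add, Nat.sub_add_cancel he])⟩
  obtain ⟨ω, hω⟩ := hroot r (by omega)
  rw [← Polynomial.map_dvd_map (Int.castRingHom K) Int.cast_injective
    (monic_prod_of_monic _ _ fun e _ => (cyclotomic.monic _ ℤ).pow _), Polynomial.map_prod]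
  simp_rw [Polynomial.map_pow, map_cyclotomic]
  have hN : IsUnit ((p ^ r : ℕ) : K[X]) := by
    rw [← C_eq_natCast, isUnit_C]
    exact (Nat.cast_ne_zero.2 (pow_pos hp.pos r).ne').isUnit
  rw [← hN.dvd_mul_left, natCast_mul_omegaPoly hB0 hB1 (pow_pos hp.pos r) hω]
  refine Finset.prod_dvd_of_coprime (fun a _ b _ hab => ?_) fun e he => dvd_sum fun s _ => ?_
  · exact (isCoprime_cyclotomic fun h => hab (Nat.pow_right_injective hp.two_le h)).pow
  · obtain ⟨he1, he2⟩ := mem_Ico.1 he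
    obtain ⟨μ, hμ⟩ := hroot e he2.le
    refine cyclotomic_pow_dvd_prod hμ (pow_pos hp.pos _) ?_ n
    rw [← pow_mul, hω.pow_eq_one_iff_dvd]
    exact (pow_dvd_pow p he1).mul_left s

end Divisibility

section Valuation

open Polynomial Finset

variable {K : Type*} [Field K] {v : AbsoluteValue K ℝ}

lemma IsNonarchimedean.aeval_le_one (hna : IsNonarchimedean v) {x : K} (hx : v x ≤ 1)
    (g : ℤ[X]) : v (aeval x g) ≤ 1 := by
  induction g using Polynomial.induction_on' with
  | add f g hf hg => rw [map_add]; exact (hna _ _).trans (max_le hf hg)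
  | monomial n a =>
    rw [aeval_monomial, map_mul, map_pow]
    exact mul_le_one₀ (by simpa using hna.apply_intCast_le_one) (by positivity)
      (pow_le_one₀ (v.nonneg _) hx)

lemma IsPrimitiveRoot.absoluteValue_eq_one {ζ : K} {m : ℕ} (hm : m ≠ 0)
    (hζ : IsPrimitiveRoot ζ m) : v ζ = 1 := by
  refine (pow_eq_one_iff_of_nonneg (v.nonneg ζ) hm).1 ?_
  rw [← map_pow, hζ.pow_eq_one, map_one]

lemma IsNonarchimedean.one_sub_pow_le (hna : IsNonarchimedean v) {x : K} (hx : v x ≤ 1) (a : ℕ) :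
    v (1 - x ^ a) ≤ v (1 - x) := by
  have h : 1 - x ^ a = aeval x (∑ i ∈ range a, (X : ℤ[X]) ^ i) * (1 - x) := by
    simp [geom_sum_mul_neg]
  rw [h, map_mul]
  exact mul_le_of_le_one_left (v.nonneg _) (hna.aeval_le_one hx _)

lemma IsNonarchimedean.one_sub_primitiveRoot_eq (hna : IsNonarchimedean v) {m : ℕ} (hm : m ≠ 0)
    {x y : K} (hx : IsPrimitiveRoot x m) (hy : IsPrimitiveRoot y m) :
    v (1 - x) = v (1 - y) := by
  have : NeZero m := ⟨hm⟩
  obtain ⟨a, -, rfl⟩ := hx.eq_pow_of_pow_eq_one hy.pow_eq_one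
  obtain ⟨b, -, hb⟩ := hy.eq_pow_of_pow_eq_one hx.pow_eq_one
  refine le_antisymm ?_ (hna.one_sub_pow_le (hx.absoluteValue_eq_one hm).le a)
  conv_lhs => rw [← hb]
  exact hna.one_sub_pow_le (hy.absoluteValue_eq_one hm).le b

variable {p : ℕ}

lemma IsNonarchimedean.one_sub_primitiveRoot_pow_totient (hna : IsNonarchimedean v)
    (hp : p.Prime) {k : ℕ} {ζ : K} (hζ : IsPrimitiveRoot ζ (p ^ (k + 1))) :
    v (1 - ζ) ^ (p ^ (k + 1)).totient = v p := by
  have : Fact p.Prime := ⟨hp⟩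
  have h := eval_one_cyclotomic_prime_pow (R := K) (p := p) k
  rw [cyclotomic_eq_prod_X_sub_primitiveRoots hζ, eval_prod] at h
  rw [← h, map_prod, ← hζ.card_primitiveRoots, ← prod_const]
  refine prod_congr rfl fun μ hμ => ?_
  rw [eval_sub, eval_X, eval_C]
  exact hna.one_sub_primitiveRoot_eq (pow_pos hp.pos _).ne' hζ
    (isPrimitiveRoot_of_mem_primitiveRoots hμ)

lemma IsNonarchimedean.aeval_cyclotomic_eq (hna : IsNonarchimedean v)
    (hp : p.Prime) {k e : ℕ} (he : e ≤ k) {ζ : K} (hζ : IsPrimitiveRoot ζ (p ^ (k + 1))) :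
    v (aeval ζ (cyclotomic (p ^ e) ℤ)) = v (1 - ζ) ^ (p ^ e).totient := by
  have : Fact p.Prime := ⟨hp⟩
  have hd : p ^ (k + 1) ≠ 0 := (pow_pos hp.pos _).ne'
  have hζ0 : ζ ≠ 0 := hζ.ne_zero hd
  have hμ₀ : IsPrimitiveRoot (ζ ^ p ^ (k + 1 - e)) (p ^ e) :=
    hζ.pow (pow_pos hp.pos _) (by rw [← pow_add, Nat.sub_add_cancel (by omega)])
  rw [aeval_def, eval₂_eq_eval_map, map_cyclotomic, cyclotomic_eq_prod_X_sub_primitiveRoots hμ₀,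
    eval_prod, map_prod, ← hμ₀.card_primitiveRoots, ← prod_const]
  refine prod_congr rfl fun μ hμ => ?_
  have hμ' := isPrimitiveRoot_of_mem_primitiveRoots hμ
  have hμe : ∀ l, e ≤ l → μ ^ p ^ l = 1 := fun l hl =>
    (hμ'.pow_eq_one_iff_dvd _).2 (pow_dvd_pow p hl)
  have hprim : IsPrimitiveRoot (ζ⁻¹ * μ) (p ^ (k + 1)) := by
    rw [← orderOf_eq_prime_pow (x := ζ⁻¹ * μ) (p := p) (n := k)]
    · exact IsPrimitiveRoot.orderOf _
    · rw [mul_pow, hμe k he, mul_one, inv_pow, inv_eq_one, hζ.pow_eq_one_iff_dvd]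
      exact fun h => absurd ((Nat.pow_dvd_pow_iff_le_right hp.one_lt).1 h) (by omega)
    · rw [mul_pow, hμe _ (by omega), mul_one, inv_pow, hζ.pow_eq_one, inv_one]
  rw [eval_sub, eval_X, eval_C, show ζ - μ = ζ * (1 - ζ⁻¹ * μ) by field_simp, map_mul,
    hζ.absoluteValue_eq_one hd, one_mul]
  exact hna.one_sub_primitiveRoot_eq hd hprim hζ

lemma sum_totient_mul_div_ge (hp : p.Prime) {r : ℕ} (hr : 1 ≤ r) (n : ℕ) :
    (r * n : ℝ) / (p : ℝ) ^ (2 * r) - 1 / ((p : ℝ) - 1) ≤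
      ((∑ e ∈ Ico r (2 * r), (p ^ e).totient * (n / p ^ e) : ℕ) : ℝ)
        / ((p ^ (2 * r)).totient : ℝ) := by
  have hp1 : (1 : ℝ) < p := by exact_mod_cast hp.one_lt
  have hp0 : (0 : ℝ) < p := by linarith
  have htot : ∀ e, 1 ≤ e → ((p ^ e).totient : ℝ) = (p : ℝ) ^ e * (p - 1) / p := by
    intro e he
    obtain ⟨k, rfl⟩ := Nat.exists_eq_add_of_le' he
    rw [Nat.totient_prime_pow_succ hp]
    push_cast [Nat.cast_sub hp.one_le]
    field_simp
    ring
  have hgeom : ∑ e ∈ Ico r (2 * r), (p : ℝ) ^ e ≤ (p : ℝ) ^ (2 * r) / (p - 1) := by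
    rw [geom_sum_Ico hp1.ne' (by omega)]
    have : (0 : ℝ) ≤ (p : ℝ) ^ r := by positivity
    gcongr
    linarith
  have hterm : ∀ e ∈ Ico r (2 * r), ((n : ℝ) - (p : ℝ) ^ e) * ((p - 1) / p) ≤
      (((p ^ e).totient * (n / p ^ e) : ℕ) : ℝ) := by
    intro e he
    have he1 := (mem_Ico.1 he).1
    have hlt : (n : ℝ) < (p : ℝ) ^ e * (((n / p ^ e : ℕ) : ℝ) + 1) := by
      exact_mod_cast Nat.lt_mul_div_succ n (pow_pos hp.pos e)
    rw [Nat.cast_mul, htot e (by omega)]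
    have hq : (0 : ℝ) ≤ (p - 1) / p := div_nonneg (by linarith) hp0.le
    calc ((n : ℝ) - (p : ℝ) ^ e) * ((p - 1) / p)
        ≤ ((p : ℝ) ^ e * ((n / p ^ e : ℕ) : ℝ)) * ((p - 1) / p) :=
          mul_le_mul_of_nonneg_right (by linarith) hq
      _ = _ := by ring
  have hsum := sum_le_sum hterm
  rw [← sum_mul, sum_sub_distrib, sum_const, Nat.card_Ico, nsmul_eq_mul,
    show 2 * r - r = r by omega] at hsum
  have hd : (0 : ℝ) < (p : ℝ) ^ (2 * r) := by positivity
  have hp1' : (0 : ℝ) < p - 1 := by linarith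
  rw [htot (2 * r) (by omega), le_div_iff₀ (by positivity), Nat.cast_sum]
  refine le_trans ?_ hsum
  calc ((r * n : ℝ) / (p : ℝ) ^ (2 * r) - 1 / ((p : ℝ) - 1)) * ((p : ℝ) ^ (2 * r) * (p - 1) / p)
      = ((r : ℝ) * n - (p : ℝ) ^ (2 * r) / (p - 1)) * ((p - 1) / p) := by field_simp
    _ ≤ _ := by gcongr

lemma AbsoluteValue.isNonarchimedean_of_extends [Fact p.Prime] [Algebra ℚ_[p] K]
    (hv : ∀ x : ℚ_[p], v (algebraMap ℚ_[p] K x) = ‖x‖) : IsNonarchimedean v := by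
  let := v.toNormedField
  have : IsUltrametricDist K :=
    IsUltrametricDist.isUltrametricDist_of_forall_norm_natCast_le_one fun n => by
      have h := hv n
      rw [map_natCast] at h
      exact h.trans_le (IsUltrametricDist.norm_natCast_le_one ℚ_[p] n)
  exact fun x y => IsUltrametricDist.norm_add_le_max x y

/-- The value of `Ω` at a root of unity agrees with that of `omegaPoly` up to a root of unity. -/
lemma aeval_omegaPoly (B : ℕ → ℕ → ℤ[X]) {N : ℕ} (hN : 0 < N) (n : ℕ) {ζ : K} (hζ : ζ ≠ 0) :
    aeval ζ (omegaPoly B N n) = ζ ^ (n.choose 2) *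
      ∑ k ∈ range (n / N + 1), (-1) ^ (k * N) *
        ζ ^ (((k * N + 1).choose 2 : ℤ) - (n * k * N : ℤ)) * aeval ζ (B n (k * N)) := by
  rw [omegaPoly, map_sum, mul_sum]
  refine sum_congr rfl fun k hk => ?_
  have hk' : k * N ≤ n := (Nat.le_div_iff_mul_le hN).1 (Nat.lt_succ_iff.1 (mem_range.1 hk))
  have hexp : (((n - k * N).choose 2 : ℕ) : ℤ) =
      (n.choose 2 : ℕ) + (((k * N + 1).choose 2 : ℤ) - (n * k * N : ℤ)) := by
    obtain ⟨m, rfl⟩ := Nat.exists_eq_add_of_le hk'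
    rw [Nat.add_sub_cancel_left]
    have h2 : ∀ a : ℕ, ((a.choose 2 : ℕ) : ℤ) * 2 = a * (a - 1) := by
      intro a
      cases a with
      | zero => simp
      | succ a =>
        rw [Nat.choose_two_right, ← Nat.cast_two (R := ℤ), ← Nat.cast_mul,
          Nat.div_mul_cancel (Nat.even_mul_pred_self _).two_dvd]
        push_cast [Nat.add_sub_cancel]; ring
    have ha := h2 m
    have hb := h2 (k * N + m)
    have hc := h2 (k * N + 1)
    push_cast at hb hc ⊢
    refine mul_right_cancel₀ (two_ne_zero (α := ℤ)) ?_
    linear_combination ha - hb - hc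
  simp only [map_mul, map_pow, map_neg, map_one, aeval_X]
  rw [← zpow_natCast ζ ((n - k * N).choose 2), hexp, zpow_add₀ hζ, zpow_natCast]
  ring

lemma omega_bound [CharZero K] [Fact p.Prime] [Algebra ℚ_[p] K]
    (hv : ∀ x : ℚ_[p], v (algebraMap ℚ_[p] K x) = ‖x‖) {B : ℕ → ℕ → ℤ[X]}
    (hB0 : ∀ n k : ℕ, n < k → B n k = 0)
    (hB1 : ∀ n k : ℕ, k ≤ n → B n k * (qPoch k * qPoch (n - k)) = qPoch n)
    {r : ℕ} (hr : 1 ≤ r) {ζ : K} (hζ : IsPrimitiveRoot ζ (p ^ (2 * r))) (n : ℕ) :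
    v (∑ k ∈ range (n / p ^ r + 1),
        (-1) ^ (k * p ^ r) *
          ζ ^ (((k * p ^ r + 1).choose 2 : ℤ) - (n * k * p ^ r : ℤ)) *
          aeval ζ (B n (k * p ^ r)))
      ≤ (p : ℝ) ^ (-((r * n : ℝ) / (p : ℝ) ^ (2 * r) - 1 / ((p : ℝ) - 1))) := by
  have hp : p.Prime := Fact.out
  have hna := AbsoluteValue.isNonarchimedean_of_extends hv
  have hd : p ^ (2 * r) ≠ 0 := (pow_pos hp.pos _).ne'
  have hvζ : v ζ = 1 := hζ.absoluteValue_eq_one hd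
  have hp1 : (1 : ℝ) < p := by exact_mod_cast hp.one_lt
  obtain ⟨k, hk⟩ : ∃ k, 2 * r = k + 1 := ⟨2 * r - 1, by omega⟩
  have hζk : IsPrimitiveRoot ζ (p ^ (k + 1)) := hk ▸ hζ
  have hvp : v (p : K) = (p : ℝ)⁻¹ := by
    rw [← Padic.norm_p (p := p), ← hv, map_natCast (algebraMap ℚ_[p] K)]
  have hc := hna.one_sub_primitiveRoot_pow_totient hp hζk
  rw [hvp, ← hk] at hc
  have htot : 0 < (p ^ (2 * r)).totient := Nat.totient_pos.2 (Nat.pos_of_ne_zero hd)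
  have hc' : v (1 - ζ) = (p : ℝ) ^ (-(1 / ((p ^ (2 * r)).totient : ℝ))) := by
    rw [Real.rpow_neg (by linarith), ← Real.inv_rpow (by linarith), ← hc, one_div,
      Real.pow_rpow_inv_natCast (v.nonneg _) htot.ne']
  have heval := congrArg v (aeval_omegaPoly B (pow_pos hp.pos r) n (hζ.ne_zero hd))
  rw [map_mul, map_pow v, hvζ, one_pow, one_mul] at heval
  push_cast at heval
  rw [← heval]
  obtain ⟨g, hg⟩ := prod_cyclotomic_dvd_omegaPoly hB0 hB1 hp hζ n
  have hD : v (aeval ζ (∏ e ∈ Ico r (2 * r), cyclotomic (p ^ e) ℤ ^ (n / p ^ e))) =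
      v (1 - ζ) ^ (∑ e ∈ Ico r (2 * r), (p ^ e).totient * (n / p ^ e)) := by
    rw [map_prod, map_prod, ← prod_pow_eq_pow_sum]
    refine prod_congr rfl fun e he => ?_
    have he2 := (mem_Ico.1 he).2
    rw [map_pow, map_pow, hna.aeval_cyclotomic_eq hp (by omega) hζk, pow_mul]
  rw [hg, map_mul, map_mul, hD]
  refine (mul_le_of_le_one_right (by positivity) (hna.aeval_le_one hvζ.le g)).trans ?_
  rw [hc', ← Real.rpow_natCast, ← Real.rpow_mul (by linarith)]
  refine Real.rpow_le_rpow_of_exponent_le hp1.le ?_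
  have := sum_totient_mul_div_ge hp hr n
  rw [neg_mul, one_div_mul_eq_div]
  linarith

end Valuation

/-- **Lower bound for `v_p(Ω_{r,n}(ζ))` and decay on the critical interval**
(Ophir–de Shalit, (4.8)).  `K` is an algebraic closure of `ℚ_p` with its unique absolute value
`v` extending the `p`-adic one.  For `ζ` a primitive `p^{2r}`-th root of unity and
`0 ≤ n ≤ p^{2r}−1`, `v_p(Ω_{r,n}(ζ)) ≥ rn/p^{2r} − 1/(p−1)` — expressed multiplicatively as
`|Ω_{r,n}(ζ)| ≤ p^{−(rn/p^{2r} − 1/(p−1))}`.  In particular, for any fixed `0 < δ < 1`,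
`max_{n ∈ [((1−δ)/2)(d−1), ((1+δ)/2)(d−1)]} |Ω_{r,n}(ζ)| → 0` as `r → ∞`.  Here
`Ω_{r,n}(ζ) = Σ_{k=0}^{⌊n/p^r⌋} (−1)^{k p^r} ζ^{(kp^r)(kp^r+1)/2 − n k p^r} [n choose kp^r]_ζ`,
and `B` is the Gaussian binomial coefficient `[n choose k]_q ∈ ℤ[q]`, characterized by
`[n choose k]_q (q;q)_k (q;q)_{n−k} = (q;q)_n` for `k ≤ n` and `[n choose k]_q = 0` for
`k > n`. -/
theorem stmt_17 (p : ℕ) [Fact p.Prime]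
    (K : Type*) [Field K] [Algebra ℚ_[p] K] [IsAlgClosure ℚ_[p] K]
    (v : AbsoluteValue K ℝ)
    (hv : ∀ x : ℚ_[p], v (algebraMap ℚ_[p] K x) = ‖x‖)
    (B : ℕ → ℕ → Polynomial ℤ)
    (hB0 : ∀ n k : ℕ, n < k → B n k = 0)
    (hB1 : ∀ n k : ℕ, k ≤ n → B n k * (qPoch k * qPoch (n - k)) = qPoch n) :
    (∀ r : ℕ, 1 ≤ r → ∀ ζ : K, IsPrimitiveRoot ζ (p ^ (2 * r)) →
      ∀ n : ℕ, n ≤ p ^ (2 * r) - 1 →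
        v (∑ k ∈ Finset.range (n / p ^ r + 1),
              (-1) ^ (k * p ^ r) *
                ζ ^ (((k * p ^ r + 1).choose 2 : ℤ) - (n * k * p ^ r : ℤ)) *
                Polynomial.aeval ζ (B n (k * p ^ r)))
          ≤ (p : ℝ) ^ (-((r * n : ℝ) / (p : ℝ) ^ (2 * r) - 1 / ((p : ℝ) - 1))))
    ∧ (∀ δ : ℝ, 0 < δ → δ < 1 → ∀ ε : ℝ, 0 < ε →
        ∃ r₀ : ℕ, ∀ r : ℕ, r₀ ≤ r → ∀ ζ : K, IsPrimitiveRoot ζ (p ^ (2 * r)) →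
          ∀ n : ℕ,
            (1 - δ) / 2 * ((p : ℝ) ^ (2 * r) - 1) ≤ (n : ℝ) →
            (n : ℝ) ≤ (1 + δ) / 2 * ((p : ℝ) ^ (2 * r) - 1) →
            v (∑ k ∈ Finset.range (n / p ^ r + 1),
                  (-1) ^ (k * p ^ r) *
                    ζ ^ (((k * p ^ r + 1).choose 2 : ℤ) - (n * k * p ^ r : ℤ)) *
                    Polynomial.aeval ζ (B n (k * p ^ r)))
              ≤ ε) := by
  have : CharZero K := charZero_of_injective_algebraMap (algebraMap ℚ_[p] K).injective
  have hp : p.Prime := Fact.out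
  have hp2 : (2 : ℝ) ≤ p := by exact_mod_cast hp.two_le
  refine ⟨fun r hr ζ hζ n _ => omega_bound hv hB0 hB1 hr hζ n, fun δ hδ0 hδ1 ε hε => ?_⟩
  have hδ' : 0 < (1 - δ) / 4 := by linarith
  have hlim : Filter.Tendsto
      (fun r : ℕ => (p : ℝ) ^ (-((1 - δ) / 4 * (r : ℝ) - 1 / ((p : ℝ) - 1))))
      Filter.atTop (nhds 0) := by
    have h0 : Filter.Tendsto (fun x : ℝ => (p : ℝ) ^ x) Filter.atBot (nhds 0) :=
      tendsto_rpow_atBot_of_base_gt_one _ (by linarith)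
    refine h0.comp (Filter.tendsto_neg_atTop_atBot.comp ?_)
    exact Filter.tendsto_atTop_add_const_right _ _
      (tendsto_natCast_atTop_atTop.const_mul_atTop hδ')
  obtain ⟨r₀, hr₀⟩ := Filter.eventually_atTop.1 (hlim.eventually_le_const hε)
  refine ⟨max r₀ 1, fun r hr ζ hζ n hn _ => ?_⟩
  have hr1 : 1 ≤ r := le_of_max_le_right hr
  refine (omega_bound hv hB0 hB1 hr1 hζ n).trans ((?_ : _ ≤ _).trans
    (hr₀ r (le_of_max_le_left hr)))
  refine Real.rpow_le_rpow_of_exponent_le (by linarith) ?_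
  have hd : (2 : ℝ) ≤ (p : ℝ) ^ (2 * r) :=
    hp2.trans (le_self_pow₀ (by linarith) (by omega))
  have hn' : (1 - δ) / 4 * (p : ℝ) ^ (2 * r) ≤ n := by nlinarith
  have : (1 - δ) / 4 * (r : ℝ) ≤ (r * n : ℝ) / (p : ℝ) ^ (2 * r) := by
    rw [le_div_iff₀ (by linarith)]
    nlinarith [mul_le_mul_of_nonneg_left hn' (Nat.cast_nonneg (α := ℝ) r)]
  linarith
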